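/- arXiv:2203.08012 — 17 statements merged into one kernel-verified Lean document; each statement's English description precedes it below -/
import Mathlib

section
/- Let (A,p,0,1) satisfy axioms (T1)–(T4). Define ā = p(1,a,0). Then 1̄ = 0, 0̄ = 1, and the map a ↦ ā is an involution: for all a ∈ A, the double complement satisfies ā̄ = a. -/
theorem stmt_0 (A : Type*) (p : A → A → A → A) (z o : A)
    (T1 : ∀ a, p z a o = a)
    (T2 : ∀ a b, p a b a = a)
    (T3 : ∀ a b₁ b₂ b₃ c, p a (p b₁ b₂ b₃) c = p (p a b₁ c) b₂ (p a b₃ c))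
    (T4a : ∀ a b, p a z b = a) (T4b : ∀ a b, p b o a = a)
    (neg : A → A) (hneg : ∀ a, neg a = p o a z) :
    neg o = z ∧ neg z = o ∧ ∀ a, neg (neg a) = a := by
  refine ⟨?_, ?_, fun a => ?_⟩
  · rw [hneg, T4b]
  · rw [hneg, T4a]
  · rw [hneg, hneg, T3, T4b, T4a, T1]
end

section
/- Let (A,p,0,1) satisfy axioms (T1)–(T4). Define ā = p(1,a,0). Then for all a,b,c ∈ A: the complement of p(a,b,c) equals p(ā, b, c̄), and p(a,b,c) = p(c, b̄, a). -/
theorem stmt_1 (A : Type*) (p : A → A → A → A) (z o : A)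
    (T1 : ∀ a, p z a o = a)
    (T2 : ∀ a b, p a b a = a)
    (T3 : ∀ a b₁ b₂ b₃ c, p a (p b₁ b₂ b₃) c = p (p a b₁ c) b₂ (p a b₃ c))
    (T4a : ∀ a b, p a z b = a) (T4b : ∀ a b, p b o a = a)
    (neg : A → A) (hneg : ∀ a, neg a = p o a z) :
    ∀ a b c, neg (p a b c) = p (neg a) b (neg c) ∧ p a b c = p c (neg b) a := by
  intro a b c
  constructor
  · rw [hneg, hneg, hneg, T3]
  · rw [hneg, T3, T4a, T4b]
end

section
/- Let (A,p,0,1) satisfy axioms (T1)–(T4). Define ā = p(1,a,0), a·b = p(0,a,b), a∘b = p(a,b,1) and a+b = p(a,b,ā). Then for all a,b ∈ A: the complement of a·b equals b̄∘ā, the complement of a∘b equals b̄·ā, and the complement of a+b equals ā+b, which also equals a+b̄. -/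
theorem stmt_2 (A : Type*) (p : A → A → A → A) (z o : A)
    (T1 : ∀ a, p z a o = a)
    (T2 : ∀ a b, p a b a = a)
    (T3 : ∀ a b₁ b₂ b₃ c, p a (p b₁ b₂ b₃) c = p (p a b₁ c) b₂ (p a b₃ c))
    (T4a : ∀ a b, p a z b = a) (T4b : ∀ a b, p b o a = a)
    (neg : A → A) (hneg : ∀ a, neg a = p o a z)
    (mul : A → A → A) (hmul : ∀ a b, mul a b = p z a b)
    (circ : A → A → A) (hcirc : ∀ a b, circ a b = p a b o)
    (add : A → A → A) (hadd : ∀ a b, add a b = p a b (neg a)) :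
    ∀ a b, neg (mul a b) = circ (neg b) (neg a) ∧
      neg (circ a b) = mul (neg b) (neg a) ∧
      neg (add a b) = add (neg a) b ∧ neg (add a b) = add a (neg b) := by
  have neg_p (x b y : A) : neg (p x b y) = p (neg x) b (neg y) := by
    simp only [hneg, T3]
  have p_neg (x b y : A) : p x (neg b) y = p y b x := by
    rw [hneg, T3, T4b, T4a]
  have neg_neg (a : A) : neg (neg a) = a := by
    rw [hneg (neg a), p_neg, T1]
  have neg_z : neg z = o := by rw [hneg, T4a]
  have neg_o : neg o = z := by rw [hneg, T4b]
  intro a b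
  simp only [hmul, hcirc, hadd, neg_p, p_neg, neg_neg, neg_z, neg_o, and_self]
end

section
/- Let (A,p,0,1) satisfy axioms (T1)–(T4). Define ā = p(1,a,0), a·b = p(0,a,b), a∘b = p(a,b,1) and a+b = p(a,b,ā). Then each of the binary operations ·, ∘ and + is associative; moreover 1 is a two-sided identity for ·, 0 is a two-sided identity for ∘, and 0 is a two-sided identity for +. Hence (A,·,1), (A,∘,0) and (A,+,0) are monoids. -/
theorem stmt_3 (A : Type*) (p : A → A → A → A) (z o : A)
    (T1 : ∀ a, p z a o = a)
    (T2 : ∀ a b, p a b a = a)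
    (T3 : ∀ a b₁ b₂ b₃ c, p a (p b₁ b₂ b₃) c = p (p a b₁ c) b₂ (p a b₃ c))
    (T4a : ∀ a b, p a z b = a) (T4b : ∀ a b, p b o a = a)
    (neg : A → A) (hneg : ∀ a, neg a = p o a z)
    (mul : A → A → A) (hmul : ∀ a b, mul a b = p z a b)
    (circ : A → A → A) (hcirc : ∀ a b, circ a b = p a b o)
    (add : A → A → A) (hadd : ∀ a b, add a b = p a b (neg a)) :
    (∀ a b c, mul (mul a b) c = mul a (mul b c)) ∧
    (∀ a, mul a o = a ∧ mul o a = a) ∧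
    (∀ a b c, circ (circ a b) c = circ a (circ b c)) ∧
    (∀ a, circ a z = a ∧ circ z a = a) ∧
    (∀ a b c, add (add a b) c = add a (add b c)) ∧
    (∀ a, add a z = a ∧ add z a = a) := by
  have neg_neg : ∀ a, neg (neg a) = a := fun a => by
    rw [hneg, hneg, T3, T4b, T4a, T1]
  have neg_add : ∀ a b, neg (add a b) = p (neg a) b a := fun a b => by
    rw [hadd, hneg, T3, ← hneg, ← hneg, neg_neg]
  have p_neg : ∀ a b, p a (neg b) (neg a) = p (neg a) b a := fun a b => by
    rw [hneg b, T3, T4b, T4a]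
  refine ⟨fun a b c => ?_, fun a => ⟨?_, ?_⟩, fun a b c => ?_, fun a => ⟨?_, ?_⟩,
    fun a b c => ?_, fun a => ⟨?_, ?_⟩⟩
  · simp only [hmul, T3, T4a]
  · rw [hmul, T1]
  · rw [hmul, T4b]
  · simp only [hcirc, T3, T4b]
  · rw [hcirc, T4a]
  · rw [hcirc, T1]
  · rw [hadd (add a b) c, neg_add, hadd a (add b c), hadd b c, T3, p_neg, ← hadd a b]
  · rw [hadd, T4a]
  · rw [hadd, hneg, T4a, T1]
end

section
/- Let (A,p,0,1) satisfy axioms (T1)–(T4). Define ā = p(1,a,0), a·b = p(0,a,b) and a∘b = p(a,b,1). If p(0,a,b) = p(a,a,b) for all a,b ∈ A, then · and ∘ are commutative, and for all a ∈ A: a·ā = 0 and a∘ā = 1. -/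
section ChurchAlgebra

variable {A : Type*} {p : A → A → A → A} {z o : A}

theorem mul_assoc_of_ternary
    (T3 : ∀ a b₁ b₂ b₃ c, p a (p b₁ b₂ b₃) c = p (p a b₁ c) b₂ (p a b₃ c))
    (T4a : ∀ a b, p a z b = a) (x y w : A) :
    p z (p z x y) w = p z x (p z y w) := by
  rw [T3, T4a]

theorem mul_swap_of_neg
    (T3 : ∀ a b₁ b₂ b₃ c, p a (p b₁ b₂ b₃) c = p (p a b₁ c) b₂ (p a b₃ c))
    (T4a : ∀ a b, p a z b = a) (T4b : ∀ a b, p b o a = a) (u a v : A) :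
    p u (p o a z) v = p v a u := by
  rw [T3, T4a, T4b]

theorem neg_mul_self_of_ternary
    (T2 : ∀ a b, p a b a = a)
    (T3 : ∀ a b₁ b₂ b₃ c, p a (p b₁ b₂ b₃) c = p (p a b₁ c) b₂ (p a b₃ c))
    (T4a : ∀ a b, p a z b = a) (T4b : ∀ a b, p b o a = a)
    (h : ∀ a b, p z a b = p a a b) (a : A) :
    p z (p o a z) a = z := by
  rw [mul_swap_of_neg T3 T4a T4b, ← h, T2]

theorem neg_neg_of_ternary
    (T1 : ∀ a, p z a o = a)
    (T3 : ∀ a b₁ b₂ b₃ c, p a (p b₁ b₂ b₃) c = p (p a b₁ c) b₂ (p a b₃ c))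
    (T4a : ∀ a b, p a z b = a) (T4b : ∀ a b, p b o a = a) (a : A) :
    p o (p o a z) z = a := by
  rw [mul_swap_of_neg T3 T4a T4b, T1]

theorem mul_neg_self_of_ternary
    (T1 : ∀ a, p z a o = a) (T2 : ∀ a b, p a b a = a)
    (T3 : ∀ a b₁ b₂ b₃ c, p a (p b₁ b₂ b₃) c = p (p a b₁ c) b₂ (p a b₃ c))
    (T4a : ∀ a b, p a z b = a) (T4b : ∀ a b, p b o a = a)
    (h : ∀ a b, p z a b = p a a b) (a : A) :
    p z a (p o a z) = z := by
  have := neg_mul_self_of_ternary T2 T3 T4a T4b h (p o a z)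
  rwa [neg_neg_of_ternary T1 T3 T4a T4b] at this

/-- Idempotence makes the relation `x · y = 0` symmetric. -/
theorem mul_eq_zero_symm_of_ternary
    (T2 : ∀ a b, p a b a = a)
    (T3 : ∀ a b₁ b₂ b₃ c, p a (p b₁ b₂ b₃) c = p (p a b₁ c) b₂ (p a b₃ c))
    (T4a : ∀ a b, p a z b = a)
    (h : ∀ a b, p z a b = p a a b) {x y : A} (hxy : p z x y = z) : p z y x = z := by
  have assoc := mul_assoc_of_ternary T3 T4a
  calc p z y x = p z (p z y x) (p z y x) := by rw [h (p z y x), T2]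
    _ = p z y (p z (p z x y) x) := by rw [assoc, assoc]
    _ = z := by rw [hxy, T4a, T2]

/-- The band `(A, ·)` is right regular. -/
theorem mul_mul_self_of_ternary
    (T1 : ∀ a, p z a o = a) (T2 : ∀ a b, p a b a = a)
    (T3 : ∀ a b₁ b₂ b₃ c, p a (p b₁ b₂ b₃) c = p (p a b₁ c) b₂ (p a b₃ c))
    (T4a : ∀ a b, p a z b = a) (T4b : ∀ a b, p b o a = a)
    (h : ∀ a b, p z a b = p a a b) (a b : A) :
    p z a (p z b a) = p z b a := by
  set c := p z b a with hc
  have mul_neg : p z c (p o a z) = z := by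
    rw [hc, mul_assoc_of_ternary T3 T4a, mul_neg_self_of_ternary T1 T2 T3 T4a T4b h, T2]
  have neg_mul : p c a z = z := by
    rw [← mul_swap_of_neg T3 T4a T4b]
    exact mul_eq_zero_symm_of_ternary T2 T3 T4a h mul_neg
  calc p z a c = p (p c c z) a (p c z z) := by rw [← h c z, T2, T4a]
    _ = c := by rw [← T3, neg_mul, T4a]

theorem eq_of_mul_eq_right_of_ternary
    (T1 : ∀ a, p z a o = a) (T2 : ∀ a b, p a b a = a)
    (T3 : ∀ a b₁ b₂ b₃ c, p a (p b₁ b₂ b₃) c = p (p a b₁ c) b₂ (p a b₃ c))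
    (T4a : ∀ a b, p a z b = a) (T4b : ∀ a b, p b o a = a)
    (h : ∀ a b, p z a b = p a a b) {a e : A}
    (hae : p z a e = e) (hea : p z e a = a) : a = e := by
  have swap := mul_swap_of_neg T3 T4a T4b
  have neg_mul := neg_mul_self_of_ternary T2 T3 T4a T4b h
  have invol := neg_neg_of_ternary T1 T3 T4a T4b
  set na := p o a z with hna
  set ne := p o e z with hne
  have ne_mul : p z ne a = z := by
    rw [← hea, ← mul_assoc_of_ternary T3 T4a, neg_mul, T4a]
  have mul_ne : p z a ne = z := mul_eq_zero_symm_of_ternary T2 T3 T4a h ne_mul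
  have na_mul_ne : p na na ne = ne := by
    calc p na na ne = p ne a z := by rw [← h, swap]
      _ = p (p ne z e) a (p ne ne e) := by rw [T4a, ← h, neg_mul]
      _ = ne := by rw [← T3, mul_ne, T4a]
  have ternary_ne : p na a ne = ne := by
    rw [hna, hne, ← T3, ← h, hae]
  have na_eq_ne : na = ne := by
    calc na = p na (p na na a) ne := by rw [← h, neg_mul, T4a]
      _ = p (p na na ne) na (p na a ne) := T3 ..
      _ = ne := by rw [na_mul_ne, ternary_ne, T2]
  rw [← invol a, ← invol e, ← hna, ← hne, na_eq_ne]

theorem mul_comm_of_ternary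
    (T1 : ∀ a, p z a o = a) (T2 : ∀ a b, p a b a = a)
    (T3 : ∀ a b₁ b₂ b₃ c, p a (p b₁ b₂ b₃) c = p (p a b₁ c) b₂ (p a b₃ c))
    (T4a : ∀ a b, p a z b = a) (T4b : ∀ a b, p b o a = a)
    (h : ∀ a b, p z a b = p a a b) (a b : A) : p z a b = p z b a := by
  have assoc := mul_assoc_of_ternary T3 T4a
  have reg := mul_mul_self_of_ternary T1 T2 T3 T4a T4b h
  have idem (x : A) : p z x x = x := by rw [h, T2]
  have key (x y : A) : p z (p z x y) (p z y x) = p z y x := by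
    rw [assoc, ← assoc y y x, idem, reg]
  exact eq_of_mul_eq_right_of_ternary T1 T2 T3 T4a T4b h (key _ _) (key _ _)

end ChurchAlgebra

theorem stmt_6 (A : Type*) (p : A → A → A → A) (z o : A)
    (T1 : ∀ a, p z a o = a)
    (T2 : ∀ a b, p a b a = a)
    (T3 : ∀ a b₁ b₂ b₃ c, p a (p b₁ b₂ b₃) c = p (p a b₁ c) b₂ (p a b₃ c))
    (T4a : ∀ a b, p a z b = a) (T4b : ∀ a b, p b o a = a)
    (neg : A → A) (hneg : ∀ a, neg a = p o a z)
    (mul : A → A → A) (hmul : ∀ a b, mul a b = p z a b)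
    (circ : A → A → A) (hcirc : ∀ a b, circ a b = p a b o)
    (h : ∀ a b, p z a b = p a a b) :
    (∀ a b, mul a b = mul b a) ∧ (∀ a b, circ a b = circ b a) ∧
    (∀ a, mul a (neg a) = z) ∧ (∀ a, circ a (neg a) = o) := by
  have comm := mul_comm_of_ternary T1 T2 T3 T4a T4b h
  have swap := mul_swap_of_neg T3 T4a T4b
  have invol := neg_neg_of_ternary T1 T3 T4a T4b
  have deMorgan (a b : A) : p a b o = p o (p z (p o b z) (p o a z)) z := by
    rw [T3, T4a, swap, invol]
  refine ⟨fun a b => ?_, fun a b => ?_, fun a => ?_, fun a => ?_⟩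
  · rw [hmul, hmul, comm]
  · rw [hcirc, hcirc, deMorgan a b, deMorgan b a, comm]
  · rw [hmul, hneg, mul_neg_self_of_ternary T1 T2 T3 T4a T4b h]
  · rw [hcirc, hneg, deMorgan, invol, mul_neg_self_of_ternary T1 T2 T3 T4a T4b h, T4a]
end

section
/- Let (A,p,0,1) satisfy axioms (T1)–(T4). Define a·b = p(0,a,b) and a∘b = p(a,b,1). If either of the monoids (A,·,1) or (A,∘,0) is commutative and idempotent, then (A,∘,·,0,1) is a bounded distributive lattice: both ∘ and · are commutative, associative and idempotent, the absorption laws a·(a∘b) = a and a∘(a·b) = a hold, each operation distributes over the other, and 0 and 1 are the bottom and top elements (a∘0 = a, a·1 = a, a∘1 = 1, a·0 = 0). -/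
theorem stmt_8 (A : Type*) (p : A → A → A → A) (z o : A)
    (T1 : ∀ a, p z a o = a)
    (T2 : ∀ a b, p a b a = a)
    (T3 : ∀ a b₁ b₂ b₃ c, p a (p b₁ b₂ b₃) c = p (p a b₁ c) b₂ (p a b₃ c))
    (T4a : ∀ a b, p a z b = a) (T4b : ∀ a b, p b o a = a)
    (mul : A → A → A) (hmul : ∀ a b, mul a b = p z a b)
    (circ : A → A → A) (hcirc : ∀ a b, circ a b = p a b o)
    (h : ((∀ a b, mul a b = mul b a) ∧ ∀ a, mul a a = a) ∨
         ((∀ a b, circ a b = circ b a) ∧ ∀ a, circ a a = a)) :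
    (∀ a b, circ a b = circ b a) ∧ (∀ a b, mul a b = mul b a) ∧
    (∀ a b c, circ (circ a b) c = circ a (circ b c)) ∧
    (∀ a b c, mul (mul a b) c = mul a (mul b c)) ∧
    (∀ a, circ a a = a) ∧ (∀ a, mul a a = a) ∧
    (∀ a b, mul a (circ a b) = a) ∧ (∀ a b, circ a (mul a b) = a) ∧
    (∀ a b c, mul a (circ b c) = circ (mul a b) (mul a c)) ∧
    (∀ a b c, circ a (mul b c) = mul (circ a b) (circ a c)) ∧
    (∀ a, circ a z = a) ∧ (∀ a, mul a o = a) ∧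
    (∀ a, circ a o = o) ∧ (∀ a, mul a z = z) := by
  have compl_compl : ∀ a, p o (p o a z) z = a := fun a => by rw [T3, T4a, T4b, T1]
  have compl_mul : ∀ a b, p o (p z a b) z = p (p o b z) (p o a z) o := fun a b => by
    rw [T3, T3, T4a, T4b, T4a]
  have compl_circ : ∀ a b, p o (p a b o) z = p z (p o b z) (p o a z) := fun a b => by
    rw [T3, T3, T4a, T4b, T4b]
  have p_mul : ∀ x b c d, p x (p z b c) d = p x b (p x c d) := fun x b c d => by
    rw [T3, T4a]
  have p_circ : ∀ x b c d, p x (p b c o) d = p (p x b d) c d := fun x b c d => by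
    rw [T3, T4b]
  obtain rfl : mul = fun a b => p z a b := funext₂ hmul
  obtain rfl : circ = fun a b => p a b o := funext₂ hcirc
  dsimp only at h ⊢
  have both : ((∀ a b, p z a b = p z b a) ∧ ∀ a, p z a a = a) ∧
      ((∀ a b, p a b o = p b a o) ∧ ∀ a, p a a o = a) := by
    rcases h with ⟨hc, hi⟩ | ⟨hc, hi⟩
    · refine ⟨⟨hc, hi⟩, fun a b => ?_, fun a => ?_⟩
      · rw [← compl_compl (p a b o), compl_circ, hc, ← compl_circ, compl_compl]
      · rw [← compl_compl (p a a o), compl_circ, hi, compl_compl]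
    · refine ⟨⟨fun a b => ?_, fun a => ?_⟩, hc, hi⟩
      · rw [← compl_compl (p z a b), compl_mul, hc, ← compl_mul, compl_compl]
      · rw [← compl_compl (p z a a), compl_mul, hi, compl_compl]
  obtain ⟨⟨mul_comm', mul_idem⟩, circ_comm, circ_idem⟩ := both
  have mul_absorb : ∀ a b, p z a (p a b o) = a := fun a b => by
    rw [mul_comm', T3, mul_idem, T4b, T2]
  have circ_absorb : ∀ a b, p a (p z a b) o = a := fun a b => by
    rw [mul_comm', p_mul, circ_idem, T2]
  refine ⟨circ_comm, mul_comm', fun a b c => (p_circ a b c o).symm, fun a b c => p_mul z a b c,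
    circ_idem, mul_idem, mul_absorb, circ_absorb, fun a b c => ?_, fun a b c => ?_,
    fun a => T4a a o, T1, fun a => T4b o a, fun a => ?_⟩
  · rw [mul_comm' a (p b c o), T3, T4b, mul_comm' b a, mul_comm' a c, p_mul,
      circ_comm (p z a b) a, circ_absorb]
  · rw [p_mul, T3, mul_absorb, T4b]
  · exact T2 z a
end

section
/- Let (A,p,0,1) satisfy axioms (T1)–(T4). Define ā = p(1,a,0), a·b = p(0,a,b) and a+b = p(a,b,ā). If a+a = 0 for all a ∈ A, then + is commutative and the right distributive law (a+b)·c = (a·c)+(b·c) holds for all a,b,c ∈ A. -/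
theorem stmt_9 (A : Type*) (p : A → A → A → A) (z o : A)
    (T1 : ∀ a, p z a o = a)
    (T2 : ∀ a b, p a b a = a)
    (T3 : ∀ a b₁ b₂ b₃ c, p a (p b₁ b₂ b₃) c = p (p a b₁ c) b₂ (p a b₃ c))
    (T4a : ∀ a b, p a z b = a) (T4b : ∀ a b, p b o a = a)
    (neg : A → A) (hneg : ∀ a, neg a = p o a z)
    (mul : A → A → A) (hmul : ∀ a b, mul a b = p z a b)
    (add : A → A → A) (hadd : ∀ a b, add a b = p a b (neg a))
    (h : ∀ a, add a a = z) :
    (∀ a b, add a b = add b a) ∧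
    (∀ a b c, mul (add a b) c = add (mul a c) (mul b c)) := by
  have z_add : ∀ a, add z a = a := fun a => by
    rw [hadd, hneg, T4a, T1]
  have add_z : ∀ a, add a z = a := fun a => by rw [hadd, T4a]
  have neg_neg : ∀ a, neg (neg a) = a := fun a => by
    rw [hneg, hneg, T3, T4b, T4a, T1]
  have neg_p : ∀ a b c, neg (p a b c) = p (neg a) b (neg c) := fun a b c => by
    simp only [hneg, T3]
  have add_assoc : ∀ a b c, add (add a b) c = add a (add b c) := fun a b c => by
    have key : p a (neg b) (neg a) = p (neg a) b a := by
      rw [hneg b, T3, T4b, T4a]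
    simp only [hadd]
    rw [T3, key, neg_p, neg_neg]
  have add_comm : ∀ a b, add a b = add b a := fun a b => by
    calc add a b = add (add (add b b) (add a b)) (add a a) := by
          rw [h b, h a, z_add, add_z]
      _ = add b (add (add (add b a) (add b a)) a) := by simp only [add_assoc]
      _ = add b a := by rw [h, z_add]
  refine ⟨add_comm, fun a b c => ?_⟩
  have add_mul_right : ∀ x b c, add x (mul b c) = p x b (add x c) := fun x b c => by
    simp only [hadd, hmul]
    rw [T3, T4a]
  have neg_mul : mul (neg a) c = add (mul a c) c := by
    rw [add_comm, add_mul_right, h, hmul, hneg, T3, T4b, T4a]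
  rw [add_mul_right, ← neg_mul, hadd, hmul, hmul, hmul, T3]
end

section
/- Let (A,p,0,1) satisfy axioms (T1)–(T4). Define a·b = p(0,a,b) and a∘b = p(a,b,1). Then the identity p(a,a,b) = a·b holds for all a,b ∈ A if and only if the identity p(a,b,b) = a∘b holds for all a,b ∈ A. -/
theorem stmt_10 (A : Type*) (p : A → A → A → A) (z o : A)
    (T1 : ∀ a, p z a o = a)
    (T2 : ∀ a b, p a b a = a)
    (T3 : ∀ a b₁ b₂ b₃ c, p a (p b₁ b₂ b₃) c = p (p a b₁ c) b₂ (p a b₃ c))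
    (T4a : ∀ a b, p a z b = a) (T4b : ∀ a b, p b o a = a)
    (mul : A → A → A) (hmul : ∀ a b, mul a b = p z a b)
    (circ : A → A → A) (hcirc : ∀ a b, circ a b = p a b o) :
    (∀ a b, p a a b = mul a b) ↔ (∀ a b, p a b b = circ a b) := by
  have n0 : p o z z = o := T4a o z
  have n1 : p o o z = z := T4b z o
  have swap : ∀ a b c, p a (p o b z) c = p c b a := fun a b c => by
    rw [T3, T4b, T4a]
  have invol : ∀ a, p o (p o a z) z = a := fun a => by rw [swap, T1]
  have inj : ∀ a b, p o a z = p o b z → a = b := fun a b h => by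
    rw [← invol a, h, invol]
  have push : ∀ a b c, p o (p a b c) z = p (p o a z) b (p o c z) := fun a b c => T3 o a b c z
  constructor
  · intro h a b
    apply inj
    rw [hcirc, push, push, n1, ← swap, h, hmul, swap]
  · intro h a b
    apply inj
    rw [hmul, push, push, n0, ← swap, h, hcirc, swap]
end

section
/- Let (A,p,0,1) satisfy axioms (T1)–(T4). Define ā = p(1,a,0), a·b = p(0,a,b) and a∘b = p(a,b,1). If p(a,a,b) = a·b for all a,b ∈ A, then (A,∘,·, ā,0,1) is a Boolean algebra: both ∘ and · are commutative, associative and idempotent, the absorption laws a·(a∘b) = a and a∘(a·b) = a hold, each operation distributes over the other, a·1 = a and a∘0 = a, and the complement laws a·ā = 0 and a∘ā = 1 hold for all a,b ∈ A. -/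
theorem stmt_11 (A : Type*) (p : A → A → A → A) (z o : A)
    (T1 : ∀ a, p z a o = a)
    (T2 : ∀ a b, p a b a = a)
    (T3 : ∀ a b₁ b₂ b₃ c, p a (p b₁ b₂ b₃) c = p (p a b₁ c) b₂ (p a b₃ c))
    (T4a : ∀ a b, p a z b = a) (T4b : ∀ a b, p b o a = a)
    (neg : A → A) (hneg : ∀ a, neg a = p o a z)
    (mul : A → A → A) (hmul : ∀ a b, mul a b = p z a b)
    (circ : A → A → A) (hcirc : ∀ a b, circ a b = p a b o)
    (h : ∀ a b, p a a b = mul a b) :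
    (∀ a b, circ a b = circ b a) ∧ (∀ a b, mul a b = mul b a) ∧
    (∀ a b c, circ (circ a b) c = circ a (circ b c)) ∧
    (∀ a b c, mul (mul a b) c = mul a (mul b c)) ∧
    (∀ a, circ a a = a) ∧ (∀ a, mul a a = a) ∧
    (∀ a b, mul a (circ a b) = a) ∧ (∀ a b, circ a (mul a b) = a) ∧
    (∀ a b c, mul a (circ b c) = circ (mul a b) (mul a c)) ∧
    (∀ a b c, circ a (mul b c) = mul (circ a b) (circ a c)) ∧
    (∀ a, circ a z = a) ∧ (∀ a, mul a o = a) ∧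
    (∀ a, circ a o = o) ∧ (∀ a, mul a z = z) ∧
    (∀ a, mul a (neg a) = z) ∧ (∀ a, circ a (neg a) = o) := by
  obtain rfl : neg = fun a => p o a z := funext hneg
  obtain rfl : mul = fun a b => p z a b := funext fun a => funext (hmul a)
  obtain rfl : circ = fun a b => p a b o := funext fun a => funext (hcirc a)
  clear hneg hmul hcirc
  beta_reduce at h ⊢
  have neg_neg : ∀ a, p o (p o a z) z = a := fun a => by rw [T3, T4b, T4a, T1]
  have p_neg : ∀ a b c, p a (p o b z) c = p c b a := fun a b c => by rw [T3, T4b, T4a]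
  have neg_p : ∀ a b c, p o (p a b c) z = p (p o a z) b (p o c z) := fun a b c => T3 ..
  have mul_assoc : ∀ a b c, p z (p z a b) c = p z a (p z b c) := fun a b c => by rw [T3, T4a]
  have circ_assoc : ∀ a b c, p (p a b o) c o = p a (p b c o) o := fun a b c => by rw [T3, T4b]
  have p_self_zero : ∀ a, p a a z = z := fun a => by rw [h, T2]
  have mul_self : ∀ a, p z a a = a := fun a => by rw [← h, T2]
  have circ_self : ∀ a, p a a o = a := fun a => by rw [h, T1]
  have neg_mul_self : ∀ a, p z (p o a z) a = z := fun a => by rw [p_neg, p_self_zero]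
  have mul_neg_self : ∀ a, p z a (p o a z) = z := fun a => by
    simpa only [neg_neg] using neg_mul_self (p o a z)
  have circ_neg_self : ∀ a, p a (p o a z) o = o := fun a => by
    rw [p_neg]
    simpa only [neg_p, T4a, T4b, T1] using congrArg (p o · z) (mul_neg_self a)
  have neg_circ_self : ∀ a, p (p o a z) a o = o := fun a => by
    simpa only [neg_neg] using circ_neg_self (p o a z)
  have p_self_right : ∀ a b, p b a a = p b a o := fun a b => by
    have hz : ∀ c, p c a (p o a z) = p c a z := fun c => by
      rw [← p_neg (p o a z) a c, h, p_neg]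
    simpa only [neg_p, T4a, T4b, T1] using congrArg (p o · z) (hz (p o b z))
  have conj_zero : ∀ a b, p z a (p z b (p o a z)) = z := fun a b => by
    rw [← mul_self (p z a (p z b (p o a z))), mul_assoc, mul_assoc,
      ← mul_assoc (p o a z) a, neg_mul_self, T4a, T2, T2]
  have mul_regular : ∀ a b, p z a (p z b a) = p z b a := fun a b => by
    have hu : p z (p o a z) (p z b a) = z := by
      simpa only [neg_neg] using conj_zero (p o a z) b
    have hc : p z (p (p o a z) a o) (p z b a) = p z b a := by rw [neg_circ_self, T4b]
    rwa [T3, hu, T4b] at hc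
  have circ_mul_self : ∀ a b, p a (p z a b) o = a := fun a b => by
    have hc : p a (p z (p z a b) (p o a z)) o = a := by rw [mul_assoc, conj_zero, T4a]
    rwa [T3, circ_neg_self, T4a] at hc
  have eq_of_mul : ∀ e f, p z e f = f → p z f e = e → e = f := fun e f hef hfe => by
    have h₁ : p f e e = f := by
      rw [p_self_right]
      simpa only [hfe] using circ_mul_self f e
    have h₂ : p (p e e f) e (p e z f) = e := by rw [← T3, p_self_zero, T4a]
    rw [h, hef, T4a] at h₂
    rw [← h₂, h₁]
  have mul_comm : ∀ a b, p z a b = p z b a := fun a b => by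
    apply eq_of_mul
    · rw [mul_assoc, ← mul_assoc b b, mul_self, mul_regular]
    · rw [mul_assoc, ← mul_assoc a a, mul_self, mul_regular]
  have circ_comm : ∀ a b, p a b o = p b a o := fun a b => by
    have hc := congrArg (p o · z) (mul_comm (p o a z) (p o b z))
    simpa only [neg_p, T4a, T4b, T1, p_neg] using hc.symm
  have mul_circ_self : ∀ a b, p z a (p a b o) = a := fun a b => by
    rw [mul_comm, T3, T4b, mul_self, T2]
  refine ⟨circ_comm, mul_comm, circ_assoc, mul_assoc, circ_self, mul_self, mul_circ_self,
    circ_mul_self, fun a b c => ?_, fun a b c => ?_, fun a => T4a .., T1, fun a => T4b ..,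
    fun a => T2 .., mul_neg_self, circ_neg_self⟩
  · rw [mul_comm a, T3, mul_comm a b, mul_comm a c, T3, T4a, T4b, circ_comm _ a, mul_comm b a,
      circ_mul_self]
  · rw [T3, T4a, T3, T4b, mul_comm a, mul_comm _ a, mul_circ_self]
end

section
/- Let (A,p,0,1) satisfy axioms (T1)–(T4). Define ā = p(1,a,0), a·b = p(0,a,b) and a∘b = p(a,b,1). Suppose (A,∘,·, ā,0,1) is a Boolean algebra, meaning: both ∘ and · are commutative, associative and idempotent, the absorption laws a·(a∘b) = a and a∘(a·b) = a hold, each operation distributes over the other, a·1 = a and a∘0 = a, and a·ā = 0 and a∘ā = 1 for all a,b ∈ A. Then p(a,b,c) = (b̄·a)∘(b·c) for all a,b,c ∈ A. -/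
/-- Two elements of a distributive lattice agree as soon as their meets with every member of a
three-element cover of the top element agree. -/
theorem eq_of_inf_eq_of_sup_eq_top {α : Type*} [DistribLattice α] [OrderTop α] {x y d e f : α}
    (hcover : d ⊔ e ⊔ f = ⊤) (hd : x ⊓ d = y ⊓ d) (he : x ⊓ e = y ⊓ e) (hf : x ⊓ f = y ⊓ f) :
    x = y := by
  rw [← inf_top_eq x, ← inf_top_eq y, ← hcover]
  simp only [inf_sup_left, hd, he, hf]

/-- An element of a Boolean algebra with the meets expected of "if `b` then `c` else `a`"
is that conditional. -/
theorem eq_compl_inf_sup_inf {α : Type*} [BooleanAlgebra α] {q a b c : α}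
    (hac : q ⊓ (a ⊓ c) = a ⊓ c) (ha : q ⊓ aᶜ = b ⊓ (c ⊓ aᶜ)) (hc : q ⊓ cᶜ = (a ⊓ cᶜ) ⊓ bᶜ) :
    q = (bᶜ ⊓ a) ⊔ (b ⊓ c) := by
  refine eq_of_inf_eq_of_sup_eq_top (d := a ⊓ c) (e := aᶜ) (f := cᶜ) ?_ ?_ ?_ ?_
  · rw [sup_assoc, ← compl_inf, sup_compl_eq_top]
  · rw [hac, eq_comm, inf_eq_right]
    calc a ⊓ c = (bᶜ ⊔ b) ⊓ (a ⊓ c) := by rw [compl_sup_eq_top, top_inf_eq]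
      _ = bᶜ ⊓ (a ⊓ c) ⊔ b ⊓ (a ⊓ c) := inf_sup_right _ _ _
      _ ≤ bᶜ ⊓ a ⊔ b ⊓ c :=
        sup_le_sup (inf_le_inf_left _ inf_le_left) (inf_le_inf_left _ inf_le_right)
  · rw [ha, inf_sup_right, inf_assoc, inf_compl_eq_bot, inf_bot_eq, bot_sup_eq, inf_assoc]
  · rw [hc, inf_sup_right, inf_assoc b, inf_compl_eq_bot, inf_bot_eq, sup_bot_eq, inf_comm,
      inf_assoc]

theorem stmt_12 (A : Type*) (p : A → A → A → A) (z o : A)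
    (T1 : ∀ a, p z a o = a)
    (T2 : ∀ a b, p a b a = a)
    (T3 : ∀ a b₁ b₂ b₃ c, p a (p b₁ b₂ b₃) c = p (p a b₁ c) b₂ (p a b₃ c))
    (T4a : ∀ a b, p a z b = a) (T4b : ∀ a b, p b o a = a)
    (neg : A → A) (hneg : ∀ a, neg a = p o a z)
    (mul : A → A → A) (hmul : ∀ a b, mul a b = p z a b)
    (circ : A → A → A) (hcirc : ∀ a b, circ a b = p a b o)
    (hcc : ∀ a b, circ a b = circ b a) (hmc : ∀ a b, mul a b = mul b a)
    (hca : ∀ a b c, circ (circ a b) c = circ a (circ b c))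
    (hma : ∀ a b c, mul (mul a b) c = mul a (mul b c))
    (hci : ∀ a, circ a a = a) (hmi : ∀ a, mul a a = a)
    (hab1 : ∀ a b, mul a (circ a b) = a) (hab2 : ∀ a b, circ a (mul a b) = a)
    (hd1 : ∀ a b c, mul a (circ b c) = circ (mul a b) (mul a c))
    (hd2 : ∀ a b c, circ a (mul b c) = mul (circ a b) (circ a c))
    (hcz : ∀ a, circ a z = a) (hmo : ∀ a, mul a o = a)
    (hcmpl1 : ∀ a, mul a (neg a) = z) (hcmpl2 : ∀ a, circ a (neg a) = o) :
    ∀ a b c, p a b c = circ (mul (neg b) a) (mul b c) := by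
  let _ : Max A := ⟨circ⟩
  let _ : Min A := ⟨mul⟩
  let _ : Lattice A := Lattice.mk' hcc hca hmc hma hab2 hab1
  let _ : BooleanAlgebra A :=
    { (inferInstance : Lattice A) with
      top := o
      bot := z
      compl := neg
      le_sup_inf := fun x y w => (hd2 x y w).ge
      le_top := fun x => inf_eq_left.mp (hmo x)
      bot_le := fun x => sup_eq_left.mp (hcz x)
      inf_compl_le_bot := fun x => (hcmpl1 x).le
      top_le_sup_compl := fun x => (hcmpl2 x).ge }
  have inf_def (x y : A) : x ⊓ y = p z x y := hmul x y
  have sup_def (x y : A) : x ⊔ y = p x y o := hcirc x y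
  have compl_def (x : A) : xᶜ = p o x z := hneg x
  have p_inf (x y w d : A) : p x y w ⊓ d = p (x ⊓ d) y (w ⊓ d) := by
    simp only [inf_def, T3]
  have compl_p (x y w : A) : (p x y w)ᶜ = p xᶜ y wᶜ := by
    simp only [compl_def, T3]
  have p_zero (x y : A) : p x y z = x ⊓ yᶜ := by
    have hz : zᶜ = o := (compl_bot : (⊥ : A)ᶜ = ⊤)
    rw [← compl_compl (p x y z), compl_p, hz, ← sup_def, compl_sup, compl_compl]
  have inf_compl (x : A) : x ⊓ xᶜ = z := hcmpl1 x
  intro a b c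
  refine eq_compl_inf_sup_inf ?_ ?_ ?_
  · rw [p_inf, inf_left_idem, inf_comm a c, inf_left_idem, T2]
  · rw [p_inf, inf_compl, inf_def b]
  · rw [p_inf, inf_compl, p_zero]
end

section
/- Let (A,p,0,1) satisfy axioms (T1)–(T4). Define ā = p(1,a,0), a·b = p(0,a,b) and a∘b = p(a,b,1). If p(a,b,c) = (b̄·a)∘(b·c) for all a,b,c ∈ A (Church's conditioned disjunction), then p(a,a,b) = a·b for all a,b ∈ A; in particular ā∘a = 1 and ā·a = 0 for all a ∈ A. -/
theorem stmt_13 (A : Type*) (p : A → A → A → A) (z o : A)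
    (T1 : ∀ a, p z a o = a)
    (T2 : ∀ a b, p a b a = a)
    (T3 : ∀ a b₁ b₂ b₃ c, p a (p b₁ b₂ b₃) c = p (p a b₁ c) b₂ (p a b₃ c))
    (T4a : ∀ a b, p a z b = a) (T4b : ∀ a b, p b o a = a)
    (neg : A → A) (hneg : ∀ a, neg a = p o a z)
    (mul : A → A → A) (hmul : ∀ a b, mul a b = p z a b)
    (circ : A → A → A) (hcirc : ∀ a b, circ a b = p a b o)
    (h : ∀ a b c, p a b c = circ (mul (neg b) a) (mul b c)) :
    (∀ a b, p a a b = mul a b) ∧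
    (∀ a, circ (neg a) a = o) ∧ (∀ a, mul (neg a) a = z) := by
  have neg_circ_self : ∀ a, circ (neg a) a = o := fun a => by
    have := h o a o
    simpa only [T2, hmul, T1, eq_comm] using this
  have neg_mul_self : ∀ a, mul (neg a) a = z := fun a => by
    have neg_neg : p o (p o a z) z = a := by rw [T3, T4b, T4a, T1]
    have key := congrArg (fun x => p o x z) (neg_circ_self a)
    simp only [hcirc, hneg] at key
    rw [T3, neg_neg, T4b] at key
    rw [hmul, hneg, T3, T4b, T4a, key]
  refine ⟨fun a b => ?_, neg_circ_self, neg_mul_self⟩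
  rw [h, neg_mul_self, hcirc, T1]
end

section
/- Let (A,p,0,1) satisfy axioms (T1)–(T4). Define ā = p(1,a,0), a·b = p(0,a,b), a∘b = p(a,b,1) and a+b = p(a,b,ā). Then (A,∘,·, ā,0,1) is a Boolean algebra (both ∘ and · commutative, associative, idempotent, satisfying the absorption laws, mutually distributive, with a·1 = a, a∘0 = a, a·ā = 0 and a∘ā = 1) if and only if (A,+,·,0,1) is a Boolean ring (+ is a commutative group operation with identity 0 in which every element is its own inverse, · is a commutative monoid operation with identity 1, · is idempotent, and · distributes over +). -/
/-- A Boolean algebra from two commutative, associative, absorbing operations, the second of which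
distributes over the first, and a complement operation. -/
abbrev booleanAlgebraOfOperations {A : Type*} (sup inf : A → A → A) (neg : A → A) (z o : A)
    (sup_comm : ∀ a b, sup a b = sup b a) (inf_comm : ∀ a b, inf a b = inf b a)
    (sup_assoc : ∀ a b c, sup (sup a b) c = sup a (sup b c))
    (inf_assoc : ∀ a b c, inf (inf a b) c = inf a (inf b c))
    (inf_sup : ∀ a b, inf a (sup a b) = a) (sup_inf : ∀ a b, sup a (inf a b) = a)
    (distrib : ∀ a b c, sup a (inf b c) = inf (sup a b) (sup a c))
    (sup_o : ∀ a, sup a o = o) (sup_z : ∀ a, sup a z = a)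
    (inf_neg : ∀ a, inf a (neg a) = z) (sup_neg : ∀ a, sup a (neg a) = o) :
    BooleanAlgebra A :=
  letI : Max A := ⟨sup⟩
  letI : Min A := ⟨inf⟩
  { Lattice.mk' sup_comm sup_assoc inf_comm inf_assoc sup_inf inf_sup with
    le_sup_inf := fun a b c => by
      change sup (inf (sup a b) (sup a c)) (sup a (inf b c)) = sup a (inf b c)
      have sup_self : ∀ x, sup x x = x := fun x => by
        simpa only [inf_sup] using sup_inf x (sup x x)
      rw [← distrib, sup_self]
    compl := neg
    top := o
    bot := z
    le_top := sup_o
    bot_le := fun a => (sup_comm z a).trans (sup_z a)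
    inf_compl_le_bot := fun a => by
      change sup (inf a (neg a)) z = z
      rw [inf_neg, sup_z]
    top_le_sup_compl := fun a => by
      change sup o (sup a (neg a)) = sup a (neg a)
      rw [sup_neg, sup_o] }

/-- A Boolean ring from an elementary abelian 2-group operation and a commutative idempotent monoid
operation distributing over it. -/
abbrev booleanRingOfOperations {A : Type*} (add mul : A → A → A) (z o : A)
    (add_comm : ∀ a b, add a b = add b a)
    (add_assoc : ∀ a b c, add (add a b) c = add a (add b c))
    (add_z : ∀ a, add a z = a) (add_self : ∀ a, add a a = z)
    (mul_comm : ∀ a b, mul a b = mul b a)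
    (mul_assoc : ∀ a b c, mul (mul a b) c = mul a (mul b c))
    (mul_o : ∀ a, mul a o = a) (mul_self : ∀ a, mul a a = a) (mul_z : ∀ a, mul a z = z)
    (left_distrib : ∀ a b c, mul a (add b c) = add (mul a b) (mul a c))
    (right_distrib : ∀ a b c, mul (add a b) c = add (mul a c) (mul b c)) :
    BooleanRing A where
  add := add
  add_assoc := add_assoc
  zero := z
  zero_add a := (add_comm z a).trans (add_z a)
  add_zero := add_z
  nsmul := @nsmulRec A ⟨z⟩ ⟨add⟩
  add_comm := add_comm
  mul := mul
  left_distrib := left_distrib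
  right_distrib := right_distrib
  zero_mul a := (mul_comm z a).trans (mul_z a)
  mul_zero := mul_z
  mul_assoc := mul_assoc
  one := o
  one_mul a := (mul_comm o a).trans (mul_o a)
  mul_one := mul_o
  neg a := a
  zsmul := @zsmulRec A ⟨z⟩ ⟨add⟩ ⟨fun a => a⟩ (@nsmulRec A ⟨z⟩ ⟨add⟩)
  neg_add_cancel := add_self
  isIdempotentElem := mul_self

/-- If `⊓` and `⊔` are given by a ternary operation satisfying the interval axioms, that operation
is the conditional of the Boolean algebra. -/
theorem ternary_eq_conditional {A : Type*} [BooleanAlgebra A] (p : A → A → A → A)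
    (T2 : ∀ a b, p a b a = a)
    (T3 : ∀ a b₁ b₂ b₃ c, p a (p b₁ b₂ b₃) c = p (p a b₁ c) b₂ (p a b₃ c))
    (p_bot : ∀ a b, p ⊥ a b = a ⊓ b) (p_top : ∀ a b, p a b ⊤ = a ⊔ b)
    (p_compl : ∀ a, p ⊤ a ⊥ = aᶜ) (a b c : A) :
    p a b c = (b ⊓ c) ⊔ (bᶜ ⊓ a) := by
  have hinf : ∀ a c d, p a b c ⊓ d = p (a ⊓ d) b (c ⊓ d) := fun a c d => by
    simp only [← p_bot, T3]
  have hsup : ∀ a c d, d ⊔ p a b c = p (d ⊔ a) b (d ⊔ c) := fun a c d => by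
    simp only [← p_top, T3]
  have htop : p ⊤ b c = bᶜ ⊔ c := by
    rw [sup_comm, ← p_compl, hsup]
    simp
  have hc : p a b c ⊓ c = (a ⊔ b) ⊓ c := by
    rw [← p_top, hinf, hinf, top_inf_eq, inf_idem]
  have ha : p a b c ⊓ a = (bᶜ ⊔ c) ⊓ a := by
    rw [← htop, hinf, hinf, top_inf_eq, inf_idem]
  have hle : p a b c ≤ a ⊔ c := by
    rw [← sup_eq_right, sup_comm, hsup, sup_eq_left.2 le_sup_left, sup_eq_left.2 le_sup_right, T2]
  rw [← inf_eq_left.2 hle, inf_sup_left, ha, hc, inf_sup_right, inf_sup_right]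
  apply le_antisymm
  · have hac : a ⊓ c ≤ b ⊓ c ⊔ bᶜ ⊓ a := by
      calc a ⊓ c = (b ⊔ bᶜ) ⊓ (a ⊓ c) := by simp
        _ = b ⊓ (a ⊓ c) ⊔ bᶜ ⊓ (a ⊓ c) := inf_sup_right ..
        _ ≤ _ := sup_le_sup (inf_le_inf_left _ inf_le_right) (inf_le_inf_left _ inf_le_left)
    exact sup_le (sup_le le_sup_right (inf_comm c a ▸ hac)) (sup_le hac le_sup_left)
  · exact sup_le (le_sup_right.trans le_sup_right) (le_sup_left.trans le_sup_left)


theorem stmt_14 (A : Type*) (p : A → A → A → A) (z o : A)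
    (T1 : ∀ a, p z a o = a)
    (T2 : ∀ a b, p a b a = a)
    (T3 : ∀ a b₁ b₂ b₃ c, p a (p b₁ b₂ b₃) c = p (p a b₁ c) b₂ (p a b₃ c))
    (T4a : ∀ a b, p a z b = a) (T4b : ∀ a b, p b o a = a)
    (neg : A → A) (hneg : ∀ a, neg a = p o a z)
    (mul : A → A → A) (hmul : ∀ a b, mul a b = p z a b)
    (circ : A → A → A) (hcirc : ∀ a b, circ a b = p a b o)
    (add : A → A → A) (hadd : ∀ a b, add a b = p a b (neg a)) :
    ((∀ a b, circ a b = circ b a) ∧ (∀ a b, mul a b = mul b a) ∧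
    (∀ a b c, circ (circ a b) c = circ a (circ b c)) ∧
    (∀ a b c, mul (mul a b) c = mul a (mul b c)) ∧
    (∀ a, circ a a = a) ∧ (∀ a, mul a a = a) ∧
    (∀ a b, mul a (circ a b) = a) ∧ (∀ a b, circ a (mul a b) = a) ∧
    (∀ a b c, mul a (circ b c) = circ (mul a b) (mul a c)) ∧
    (∀ a b c, circ a (mul b c) = mul (circ a b) (circ a c)) ∧
    (∀ a, circ a z = a) ∧ (∀ a, mul a o = a) ∧
    (∀ a, circ a o = o) ∧ (∀ a, mul a z = z) ∧
    (∀ a, mul a (neg a) = z) ∧ (∀ a, circ a (neg a) = o))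
    ↔
    ((∀ a b, add a b = add b a) ∧
     (∀ a b c, add (add a b) c = add a (add b c)) ∧
     (∀ a, add a z = a) ∧ (∀ a, add a a = z) ∧
     (∀ a b, mul a b = mul b a) ∧
     (∀ a b c, mul (mul a b) c = mul a (mul b c)) ∧
     (∀ a, mul a o = a) ∧ (∀ a, mul a a = a) ∧
     (∀ a b c, mul a (add b c) = add (mul a b) (mul a c)) ∧
     (∀ a b c, mul (add a b) c = add (mul a c) (mul b c))) := by
  have mul_z : ∀ a, mul a z = z := fun a => by rw [hmul, T2]
  constructor
  · rintro ⟨circ_comm, mul_comm, circ_assoc, mul_assoc, -, mul_self, mul_circ, circ_mul, -,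
      circ_distrib, circ_z, mul_o, circ_o, -, mul_neg, circ_neg⟩
    let _ : BooleanAlgebra A := booleanAlgebraOfOperations circ mul neg z o circ_comm mul_comm
      circ_assoc mul_assoc mul_circ circ_mul circ_distrib circ_o circ_z mul_neg circ_neg
    have mul_eq : ∀ a b, mul a b = a ⊓ b := fun _ _ => rfl
    have add_eq : ∀ a b, add a b = symmDiff a b := fun a b => by
      rw [hadd, ternary_eq_conditional p T2 T3 (fun a b => (hmul a b).symm)
        (fun a b => (hcirc a b).symm) (fun a => (hneg a).symm), symmDiff_eq, sup_comm,
        inf_comm bᶜ a]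
      rfl
    refine ⟨?_, ?_, ?_, ?_, mul_comm, mul_assoc, mul_o, mul_self, ?_, ?_⟩
    · simp only [add_eq]
      exact symmDiff_comm
    · simp only [add_eq]
      exact symmDiff_assoc
    · simp only [add_eq]
      exact symmDiff_bot
    · simp only [add_eq]
      exact symmDiff_self
    · simp only [add_eq, mul_eq]
      exact inf_symmDiff_distrib_left
    · simp only [add_eq, mul_eq]
      exact inf_symmDiff_distrib_right
  · rintro ⟨add_comm, add_assoc, add_z, add_self, mul_comm, mul_assoc, mul_o, mul_self,
      left_distrib, right_distrib⟩
    let _ : BooleanRing A := booleanRingOfOperations add mul z o add_comm add_assoc add_z add_self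
      mul_comm mul_assoc mul_o mul_self mul_z left_distrib right_distrib
    let _ : BooleanAlgebra A := BooleanRing.toBooleanAlgebra
    have mul_eq : ∀ a b, mul a b = a ⊓ b := fun _ _ => rfl
    have neg_eq : ∀ a, neg a = aᶜ := fun a => by
      have h : neg a = a + 1 := by
        change neg a = add a o
        rw [hadd, T4b]
      rw [h, _root_.add_comm]
      rfl
    have circ_eq : ∀ a b, circ a b = a ⊔ b := fun a b => by
      have h : circ a b = neg (mul (neg b) (neg a)) := by
        simp only [hcirc, hmul, hneg, T3, T4a, T4b, T1]
      rw [h, mul_eq, neg_eq, neg_eq, neg_eq, compl_inf, compl_compl, compl_compl, sup_comm]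
    simp only [mul_eq, neg_eq, circ_eq]
    exact ⟨sup_comm, inf_comm, sup_assoc, inf_assoc, sup_idem, inf_idem, fun _ _ => inf_sup_self,
      fun _ _ => sup_inf_self, inf_sup_left, sup_inf_left, sup_bot_eq, inf_top_eq, sup_top_eq,
      inf_bot_eq, fun _ => inf_compl_self _, fun _ => sup_compl_eq_top⟩
end

section
/- Let (A,+,·,0,1,−) be a unitary Abelian right near-ring in which a·0 = 0 for all a, that is: (A,+,0,−) is an abelian group, (A,·,1) is a monoid, the right distributive law (a+b)·c = a·c + b·c holds, and a·0 = 0 for all a ∈ A. Then the ternary operation p(a,b,c) = a + b·(c − a) together with the constants 0 and 1 satisfies the axioms (T1)–(T4): p(0,a,1) = a; p(a,b,a) = a; p(a, p(b₁,b₂,b₃), c) = p(p(a,b₁,c), b₂, p(a,b₃,c)); and p(a,0,b) = a = p(b,1,a), for all elements of A. -/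
theorem stmt_15 (A : Type*) (add : A → A → A) (mul : A → A → A)
    (neg : A → A) (zero one : A)
    (hadd_assoc : ∀ a b c, add (add a b) c = add a (add b c))
    (hadd_comm : ∀ a b, add a b = add b a)
    (hadd_zero : ∀ a, add a zero = a)
    (hadd_neg : ∀ a, add a (neg a) = zero)
    (hmul_assoc : ∀ a b c, mul (mul a b) c = mul a (mul b c))
    (hmul_one : ∀ a, mul a one = a)
    (hone_mul : ∀ a, mul one a = a)
    (hrdistrib : ∀ a b c, mul (add a b) c = add (mul a c) (mul b c))
    (hmul_zero : ∀ a, mul a zero = zero)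
    (p : A → A → A → A)
    (hp : ∀ a b c, p a b c = add a (mul b (add c (neg a)))) :
    (∀ a, p zero a one = a) ∧
    (∀ a b, p a b a = a) ∧
    (∀ a b₁ b₂ b₃ c, p a (p b₁ b₂ b₃) c = p (p a b₁ c) b₂ (p a b₃ c)) ∧
    (∀ a b, p a zero b = a) ∧ (∀ a b, p b one a = a) := by
  have hzero_add : ∀ a, add zero a = a := fun a => by rw [hadd_comm, hadd_zero]
  have cancel_left : ∀ a b c, add a b = add a c → b = c := fun a b c h => by
    have key : ∀ x, add (neg a) (add a x) = x := fun x => by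
      rw [← hadd_assoc, hadd_comm (neg a), hadd_neg, hzero_add]
    rw [← key b, h, key]
  have neg_zero' : neg zero = zero := by rw [← hzero_add (neg zero), hadd_neg]
  have hzero_mul : ∀ a, mul zero a = zero := fun a =>
    cancel_left (mul zero a) _ _ (by rw [← hrdistrib, hadd_zero, hadd_zero])
  have add_sub_cancel : ∀ a c, add a (add c (neg a)) = c := fun a c => by
    rw [hadd_comm c, ← hadd_assoc, hadd_neg, hzero_add]
  have sub_mul' : ∀ a b d, mul (add a (neg b)) d = add (mul a d) (neg (mul b d)) :=
    fun a b d => cancel_left (mul b d) _ _ (by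
      rw [← hrdistrib, add_sub_cancel, add_sub_cancel])
  have add_sub_add_left : ∀ a x y, add (add a x) (neg (add a y)) = add x (neg y) :=
    fun a x y => cancel_left (add a y) _ _ (by
      rw [add_sub_cancel, hadd_assoc, add_sub_cancel])
  refine ⟨fun a => ?_, fun a b => ?_, fun a b₁ b₂ b₃ c => ?_, fun a b => ?_, fun a b => ?_⟩
  · rw [hp, neg_zero', hadd_zero, hmul_one, hzero_add]
  · rw [hp, hadd_neg, hmul_zero, hadd_zero]
  · simp only [hp]
    rw [add_sub_add_left, hrdistrib, hmul_assoc, sub_mul', hadd_assoc]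
  · rw [hp, hzero_mul, hadd_zero]
  · rw [hp, hone_mul, add_sub_cancel]
end

section
/- Let (A,p,0,1) satisfy axioms (T1)–(T4). Define ā = p(1,a,0), a·b = p(0,a,b) and a+b = p(a,b,ā). If the left distributive law a·(b+c) = (a·b)+(a·c) holds for all a,b,c ∈ A, then (A,+,·,0,1) is a unitary ring of characteristic 2: + is a commutative, associative operation with identity 0 in which a+a = 0 for all a (so every element is its own additive inverse), · is associative with identity 1, and both distributive laws a·(b+c) = a·b + a·c and (a+b)·c = a·c + b·c hold. Conversely, if (A,+,·,0,1) is such a ring then the left distributive law holds. -/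
theorem stmt_16 (A : Type*) (p : A → A → A → A) (z o : A)
    (T1 : ∀ a, p z a o = a)
    (T2 : ∀ a b, p a b a = a)
    (T3 : ∀ a b₁ b₂ b₃ c, p a (p b₁ b₂ b₃) c = p (p a b₁ c) b₂ (p a b₃ c))
    (T4a : ∀ a b, p a z b = a) (T4b : ∀ a b, p b o a = a)
    (neg : A → A) (hneg : ∀ a, neg a = p o a z)
    (mul : A → A → A) (hmul : ∀ a b, mul a b = p z a b)
    (add : A → A → A) (hadd : ∀ a b, add a b = p a b (neg a)) :
    (∀ a b c, mul a (add b c) = add (mul a b) (mul a c)) ↔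
    ((∀ a b, add a b = add b a) ∧
     (∀ a b c, add (add a b) c = add a (add b c)) ∧
     (∀ a, add a z = a ∧ add z a = a) ∧ (∀ a, add a a = z) ∧
     (∀ a b c, mul (mul a b) c = mul a (mul b c)) ∧
     (∀ a, mul a o = a ∧ mul o a = a) ∧
     (∀ a b c, mul a (add b c) = add (mul a b) (mul a c)) ∧
     (∀ a b c, mul (add a b) c = add (mul a c) (mul b c))) := by
  constructor
  swap
  · rintro ⟨-, -, -, -, -, -, h, -⟩
    exact h
  intro ldistrib
  have neg_neg : ∀ a, neg (neg a) = a := fun a => by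
    rw [hneg (neg a), hneg a, T3, T4b, T4a, T1]
  have p_neg : ∀ a b c, p a (neg b) c = p c b a := fun a b c => by
    rw [hneg, T3, T4b, T4a]
  have add_neg : ∀ a b, add a (neg b) = neg (add a b) := fun a b => by
    rw [hadd, p_neg, hadd, hneg (p a b (neg a)), T3, ← hneg, ← hneg, neg_neg]
  have add_assoc : ∀ a b c, add (add a b) c = add a (add b c) := fun a b c => by
    rw [hadd b c, hadd a (p b c (neg b)), T3, ← hadd a b, ← hadd a (neg b), add_neg,
      ← hadd]
  have add_zero : ∀ a, add a z = a := fun a => by rw [hadd, T4a]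
  have neg_one : neg o = z := by rw [hneg, T4b]
  have neg_zero : neg z = o := by rw [hneg, T4a]
  have zero_add : ∀ a, add z a = a := fun a => by rw [hadd, neg_zero, T1]
  have mul_one : ∀ a, mul a o = a := fun a => by rw [hmul, T1]
  have add_self : ∀ a, add a a = z := fun a => by
    have h := ldistrib a o o
    rwa [hadd o o, T4b, neg_one, mul_one, hmul, T2, eq_comm] at h
  have add_cancel_left : ∀ a b, add a (add a b) = b := fun a b => by
    rw [← add_assoc, add_self, zero_add]
  have add_comm : ∀ a b, add a b = add b a := fun a b => by
    calc add a b = add b (add b (add a b)) := (add_cancel_left _ _).symm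
      _ = add b (add a (add a (add b (add a b)))) := by rw [add_cancel_left a]
      _ = add b (add a (add (add a b) (add a b))) := by rw [add_assoc a b (add a b)]
      _ = add b a := by rw [add_self, add_zero]
  have neg_mul : ∀ a c, mul (neg a) c = add (mul a c) c := fun a c => by
    rw [add_comm, hmul, p_neg, hadd, hmul, T3, T4a, ← hadd, add_self]
  have add_mul : ∀ a b c, mul (add a b) c = add (mul a c) (mul b c) := fun a b c => by
    rw [hadd (mul a c), hmul b c, T3, T4a, ← hadd, ← neg_mul, hmul (add a b), hadd a b, T3,
      ← hmul, ← hmul]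
  have mul_assoc : ∀ a b c, mul (mul a b) c = mul a (mul b c) := fun a b c => by
    rw [hmul (mul a b), hmul a b, T3, T4a, ← hmul, ← hmul]
  have one_mul : ∀ a, mul o a = a := fun a => by rw [hmul, T4b]
  exact ⟨add_comm, add_assoc, fun a => ⟨add_zero a, zero_add a⟩, add_self, mul_assoc,
    fun a => ⟨mul_one a, one_mul a⟩, ldistrib, add_mul⟩
end

section
/- Let (A,p,0,1) satisfy axioms (T1)–(T4). Define ā = p(1,a,0), a·b = p(0,a,b) and a+b = p(a,b,ā). Then the identity p(a,b,c) = (b̄·a)+(b·c) holds for all a,b,c ∈ A if and only if the left distributive law a·(b+c) = (a·b)+(a·c) holds for all a,b,c ∈ A. -/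
/-- A ternary operation with two constants satisfying the axioms (T1)–(T4). -/
structure IsTernarySystem {A : Type*} (p : A → A → A → A) (z o : A) : Prop where
  zero_one (a : A) : p z a o = a
  idem (a b : A) : p a b a = a
  distrib (a b₁ b₂ b₃ c : A) : p a (p b₁ b₂ b₃) c = p (p a b₁ c) b₂ (p a b₃ c)
  mid_zero (a b : A) : p a z b = a
  mid_one (a b : A) : p b o a = a

namespace IsTernarySystem

variable {A : Type*} {p : A → A → A → A} {z o : A}

local notation:max "∼" a:max => p o a z
local notation:70 a:70 "⊡" b:71 => p z a b
local notation:65 a:65 "∔" b:66 => p a b (p o a z)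

section Basic

variable (h : IsTernarySystem p z o)
include h

theorem neg_neg (a : A) : ∼(∼a) = a := by
  rw [h.distrib, h.mid_one, h.mid_zero, h.zero_one]

theorem mid_neg (a b c : A) : p a ∼b c = p c b a := by
  rw [h.distrib, h.mid_one, h.mid_zero]

theorem mid_mul (a b c d : A) : p a (b ⊡ c) d = p a b (p a c d) := by
  rw [h.distrib, h.mid_zero]

theorem neg_add (a b : A) : ∼(a ∔ b) = ∼a ∔ b :=
  h.distrib ..

theorem add_neg (a b : A) : a ∔ ∼b = ∼(a ∔ b) := by
  rw [h.mid_neg, h.neg_add, h.neg_neg]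

theorem add_ternary (x a b c : A) : x ∔ p a b c = p (x ∔ a) b (x ∔ c) :=
  h.distrib ..

theorem add_mul_eq (x b c : A) : x ∔ b ⊡ c = p x b (x ∔ c) :=
  h.mid_mul ..

end Basic

section SelfInverse

variable (h : IsTernarySystem p z o) (hself : ∀ x, p x x (p o x z) = z)
include h hself

theorem add_add_cancel (x y : A) : x ∔ (x ∔ y) = y := by
  rw [h.add_ternary, h.add_neg, hself, h.mid_zero, h.zero_one]

theorem add_assoc (x y w : A) : (x ∔ y) ∔ w = x ∔ (y ∔ w) := by
  have hx : x ∔ ((x ∔ y) ∔ w) = y ∔ w := by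
    rw [h.add_ternary, h.add_neg, h.add_add_cancel hself]
  rw [← hx, h.add_add_cancel hself]

theorem ternary_eq_add_mul_add (x b c : A) : p x b c = x ∔ b ⊡ (x ∔ c) := by
  rw [h.add_mul_eq, h.add_add_cancel hself]

theorem neg_mul (a b : A) : ∼b ⊡ a = a ∔ b ⊡ a := by
  rw [h.add_mul_eq, hself, h.mid_neg]

theorem ternary_eq_iff (a b c : A) :
    p a b c = (∼b ⊡ a) ∔ (b ⊡ c) ↔ b ⊡ (a ∔ c) = (b ⊡ a) ∔ (b ⊡ c) := by
  rw [h.ternary_eq_add_mul_add hself a b c, h.neg_mul hself a b, h.add_assoc hself]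
  have hinj : Function.Injective fun t => a ∔ t :=
    Function.LeftInverse.injective (g := fun t => a ∔ t) (h.add_add_cancel hself a)
  exact hinj.eq_iff

end SelfInverse

end IsTernarySystem

theorem stmt_17 (A : Type*) (p : A → A → A → A) (z o : A)
    (T1 : ∀ a, p z a o = a)
    (T2 : ∀ a b, p a b a = a)
    (T3 : ∀ a b₁ b₂ b₃ c, p a (p b₁ b₂ b₃) c = p (p a b₁ c) b₂ (p a b₃ c))
    (T4a : ∀ a b, p a z b = a) (T4b : ∀ a b, p b o a = a)
    (neg : A → A) (hneg : ∀ a, neg a = p o a z)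
    (mul : A → A → A) (hmul : ∀ a b, mul a b = p z a b)
    (add : A → A → A) (hadd : ∀ a b, add a b = p a b (neg a)) :
    (∀ a b c, p a b c = add (mul (neg b) a) (mul b c)) ↔
    (∀ a b c, mul a (add b c) = add (mul a b) (mul a c)) := by
  have h : IsTernarySystem p z o := ⟨T1, T2, T3, T4a, T4b⟩
  simp only [hadd, hmul, hneg]
  constructor
  · intro H
    have hself (x : A) : p x x (p o x z) = z := by
      have hx := H o x o
      have hn := h.neg_add x x
      simp only [T1, T2] at hx hn
      rw [← h.neg_neg (p x x (p o x z)), hn, ← hx, T4b]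
    exact fun a b c => (h.ternary_eq_iff hself b a c).1 (H b a c)
  · intro H
    have hself (x : A) : p x x (p o x z) = z := by
      have hx := H x o o
      simp only [T1, T2, T4b] at hx
      exact hx.symm
    exact fun a b c => (h.ternary_eq_iff hself a b c).2 (H b a c)
end

section
/- Let (A,p,0,1) satisfy axioms (T1)–(T4). Define ā = p(1,a,0), a·b = p(0,a,b) and a+b = p(a,b,ā). If a+a = 0 for all a ∈ A, then a + p(a,b,c) = b·(a+c) for all a,b,c ∈ A. -/
theorem stmt_18 (A : Type*) (p : A → A → A → A) (z o : A)
    (T1 : ∀ a, p z a o = a)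
    (T2 : ∀ a b, p a b a = a)
    (T3 : ∀ a b₁ b₂ b₃ c, p a (p b₁ b₂ b₃) c = p (p a b₁ c) b₂ (p a b₃ c))
    (T4a : ∀ a b, p a z b = a) (T4b : ∀ a b, p b o a = a)
    (neg : A → A) (hneg : ∀ a, neg a = p o a z)
    (mul : A → A → A) (hmul : ∀ a b, mul a b = p z a b)
    (add : A → A → A) (hadd : ∀ a b, add a b = p a b (neg a))
    (h : ∀ a, add a a = z) :
    ∀ a b c, add a (p a b c) = mul b (add a c) := by
  intro a b c
  have haa : p a a (neg a) = z := by rw [← hadd, h]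
  rw [hadd, T3, haa, hmul, hadd]
end

section
/- Let (A,p,0,1) satisfy axioms (T1)–(T4). Define ā = p(1,a,0), a·b = p(0,a,b) and a+b = p(a,b,ā). Then the following three conditions are equivalent: (a) a+a = 0 for all a ∈ A; (b) p(a,b,c) = a + (b·(a+c)) for all a,b,c ∈ A; (c) the right distributive law (a+b)·c = (a·c)+(b·c) holds for all a,b,c ∈ A. Moreover, under any of these conditions, (A,+,·,0,1) is a unitary right near-ring of characteristic 2: + is a commutative, associative operation with identity 0 in which every element is its own inverse, and · is associative with identity 1. -/
theorem stmt_19 (A : Type*) (p : A → A → A → A) (z o : A)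
    (T1 : ∀ a, p z a o = a)
    (T2 : ∀ a b, p a b a = a)
    (T3 : ∀ a b₁ b₂ b₃ c, p a (p b₁ b₂ b₃) c = p (p a b₁ c) b₂ (p a b₃ c))
    (T4a : ∀ a b, p a z b = a) (T4b : ∀ a b, p b o a = a)
    (neg : A → A) (hneg : ∀ a, neg a = p o a z)
    (mul : A → A → A) (hmul : ∀ a b, mul a b = p z a b)
    (add : A → A → A) (hadd : ∀ a b, add a b = p a b (neg a)) :
    ((∀ a : A, add a a = z) ↔ (∀ a b c, p a b c = add a (mul b (add a c)))) ∧
    ((∀ a b c, p a b c = add a (mul b (add a c))) ↔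
      (∀ a b c, mul (add a b) c = add (mul a c) (mul b c))) ∧
    ((∀ a : A, add a a = z) →
      ((∀ a b, add a b = add b a) ∧
       (∀ a b c, add (add a b) c = add a (add b c)) ∧
       (∀ a, add a z = a ∧ add z a = a) ∧ (∀ a, add a a = z) ∧
       (∀ a b c, mul (mul a b) c = mul a (mul b c)) ∧
       (∀ a, mul a o = a ∧ mul o a = a))) := by
  have mul_one' : ∀ a, mul a o = a := fun a => by rw [hmul, T1]
  have one_mul' : ∀ a, mul o a = a := fun a => by rw [hmul, T4b]
  have zero_mul' : ∀ a, mul z a = z := fun a => by rw [hmul, T4a]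
  have mul_assoc' : ∀ a b c, mul (mul a b) c = mul a (mul b c) := fun a b c => by
    simp only [hmul, T3, T4a]
  have add_zero' : ∀ a, add a z = a := fun a => by rw [hadd, T4a]
  have one_add_one : add o o = z := by simp only [hadd, hneg, T4b]
  have zero_add' : ∀ a, add z a = a := fun a => by
    rw [hadd, hneg, T4a, T1]
  have p_swap : ∀ a b c, p a (neg b) c = p c b a := fun a b c => by
    rw [hneg, T3, T4b, T4a]
  have neg_neg' : ∀ a, neg (neg a) = a := fun a => by
    rw [hneg (neg a), p_swap, T1]
  have neg_p : ∀ a b c, neg (p a b c) = p (neg a) b (neg c) := fun a b c => by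
    simp only [hneg, T3]
  have add_assoc' : ∀ a b c, add (add a b) c = add a (add b c) := fun a b c => by
    simp only [hadd]
    rw [neg_p, neg_neg', T3, p_swap]
  have p_eq_of_add_self (h : ∀ a, add a a = z) (a b c : A) :
      p a b c = add a (mul b (add a c)) := by
    have key : mul b (add a c) = add a (p a b c) := by
      rw [hmul, ← h a, hadd, hadd, hadd, T3]
    rw [key, ← add_assoc', h, zero_add']
  have add_self_of_p_eq (h : ∀ a b c, p a b c = add a (mul b (add a c))) (a : A) :
      add a a = z := by
    have := h a o z
    rw [T4b, one_mul', add_zero'] at this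
    exact this.symm
  have add_self_of_distrib (h : ∀ a b c, mul (add a b) c = add (mul a c) (mul b c)) (a : A) :
      add a a = z := by
    have := h o o a
    rw [one_add_one, zero_mul', one_mul'] at this
    exact this.symm
  have add_comm' (h : ∀ a, add a a = z) (a b : A) : add a b = add b a := by
    calc add a b = add (add b (add b a)) b := by rw [← add_assoc', h, zero_add']
      _ = add b (add a (add (add a (add b a)) b)) := by
        rw [← add_assoc' a (add a (add b a)) b, ← add_assoc' a a, h, zero_add', add_assoc']
      _ = add b (add a (add (add a b) (add a b))) := by simp only [add_assoc']
      _ = add b a := by rw [h, add_zero']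
  have distrib_of_p_eq (h : ∀ a b c, p a b c = add a (mul b (add a c))) (a b c : A) :
      mul (add a b) c = add (mul a c) (mul b c) := by
    have hs := add_self_of_p_eq h
    have neg_mul' : mul (neg a) c = add c (mul a c) := by
      rw [hmul, p_swap, h, add_zero']
    calc mul (add a b) c = p (mul a c) b (mul (neg a) c) := by simp only [hadd, hmul, T3]
      _ = add (mul a c) (mul b c) := by
        rw [h, neg_mul', add_comm' hs c, ← add_assoc' (mul a c) (mul a c) c, hs, zero_add']
  exact ⟨⟨p_eq_of_add_self, add_self_of_p_eq⟩,
    ⟨distrib_of_p_eq, fun h => p_eq_of_add_self (add_self_of_distrib h)⟩,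
    fun h => ⟨add_comm' h, add_assoc', fun a => ⟨add_zero' a, zero_add' a⟩, h, mul_assoc',
      fun a => ⟨mul_one' a, one_mul' a⟩⟩⟩
end
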